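/- Let m_M denote the product of all monomials in a finite multicomplex M. The compression operation C_i satisfies: deg(m_{C_i(M)}) = deg(m_M), and m_{C_i(M)} ⪰ m_M in revlex, with equality if and only if C_i(M) = M. Consequently, iterating the operations C_1, ..., C_m cyclically on a finite multicomplex M ⊆ S_d(X,(∞,a)) terminates at a (0)-compressed multicomplex with the same F-vector as M. -/

import Mathlib

open Finset

variable {X : Type*} [Fintype X] [LinearOrder X]

def degM (μ : X →₀ ℕ) : ℕ := ∑ x, μ x

def degC (c : X → ℕ) (i : ℕ) (μ : X →₀ ℕ) : ℕ :=
  ∑ x ∈ Finset.univ.filter (fun x => c x = i), μ x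

def InS (c : X → ℕ) (a : ℕ → ℕ) (m d : ℕ) (μ : X →₀ ℕ) : Prop :=
  degM μ ≤ d ∧ ∀ i, 1 ≤ i → i ≤ m → degC c i μ ≤ a i

/-- Revlex order on equal-degree monomials (`≻` on variables is `>`). -/
def MonRevGT (μ ν : X →₀ ℕ) : Prop :=
  ∃ x, μ x < ν x ∧ ∀ y, y < x → μ y = ν y

def MonRevGTOn (P : X → Prop) (μ ν : X →₀ ℕ) : Prop :=
  ∃ x, P x ∧ μ x < ν x ∧ ∀ y, P y → y < x → μ y = ν y

def DivClosed (M : Finset (X →₀ ℕ)) : Prop :=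
  ∀ μ ∈ M, ∀ ν : X →₀ ℕ, (∀ x, ν x ≤ μ x) → ν ∈ M

def FVec (M : Finset (X →₀ ℕ)) (j : ℕ) : ℕ := (M.filter (fun μ => degM μ = j)).card

def Compressed0i (c : X → ℕ) (a : ℕ → ℕ) (m d i : ℕ) (M : Finset (X →₀ ℕ)) : Prop :=
  ∀ μ ∈ M, ∀ μ' : X →₀ ℕ, InS c a m d μ' → degM μ' = degM μ →
    (∀ x, c x ≠ 0 → c x ≠ i → μ' x = μ x) →
    MonRevGTOn (fun x => c x = 0 ∨ c x = i) μ' μ → μ' ∈ M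

noncomputable def outp (c : X → ℕ) (i : ℕ) (μ : X →₀ ℕ) : X →₀ ℕ :=
  Finsupp.equivFunOnFinite.symm (fun x => if c x ≠ 0 ∧ c x ≠ i then μ x else 0)

noncomputable def innp (c : X → ℕ) (i : ℕ) (μ : X →₀ ℕ) : X →₀ ℕ :=
  Finsupp.equivFunOnFinite.symm (fun x => if c x = 0 ∨ c x = i then μ x else 0)

open Classical in
/-- The revlex-first `k` elements of a finite set `A` of monomials. -/
noncomputable def firstSeg (A : Finset (X →₀ ℕ)) (k : ℕ) : Finset (X →₀ ℕ) :=
  A.filter (fun μ => (A.filter (fun ν => ν = μ ∨ MonRevGT ν μ)).card ≤ k)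

/-- The fiber `M_ν` of the multicomplex `M` over a monomial `ν` supported outside
`X₀ ∪ X_i`. -/
noncomputable def fiber (c : X → ℕ) (i : ℕ) (M : Finset (X →₀ ℕ)) (ν : X →₀ ℕ) :
    Finset (X →₀ ℕ) :=
  (M.filter (fun μ => outp c i μ = ν)).image (innp c i)

/-- The compressed fiber `M'_ν`: in each degree `j`, the revlex-first `F_j(M_ν)` monomials
of the ambient set `Amb i j` (the degree-`j` monomials of `S_d(X₀ ∪ X_i, a_i)`). -/
noncomputable def compFiber (Amb : ℕ → ℕ → Finset (X →₀ ℕ)) (c : X → ℕ) (d i : ℕ)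
    (M : Finset (X →₀ ℕ)) (ν : X →₀ ℕ) : Finset (X →₀ ℕ) :=
  (Finset.range (d + 1)).biUnion (fun j => firstSeg (Amb i j) (FVec (fiber c i M ν) j))

/-- The compression operation `C_i`. -/
noncomputable def CiOp (Amb : ℕ → ℕ → Finset (X →₀ ℕ)) (c : X → ℕ) (d i : ℕ)
    (M : Finset (X →₀ ℕ)) : Finset (X →₀ ℕ) :=
  (M.image (outp c i)).biUnion (fun ν => (compFiber Amb c d i M ν).image (fun μ => μ + ν))

/-- The potential `m_M`, the product of all monomials of `M`. -/
noncomputable def potM (M : Finset (X →₀ ℕ)) : X →₀ ℕ := ∑ μ ∈ M, μ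

/-- Iterating `C_1, …, C_m` cyclically. -/
noncomputable def seqM (Amb : ℕ → ℕ → Finset (X →₀ ℕ)) (c : X → ℕ) (m d : ℕ)
    (M : Finset (X →₀ ℕ)) : ℕ → Finset (X →₀ ℕ)
  | 0 => M
  | (t + 1) => CiOp Amb c d (t % m + 1) (seqM Amb c m d M t)

set_option linter.unusedSectionVars false
set_option linter.unusedSimpArgs false
set_option linter.style.haveILetI false

lemma pot_lt {ι κ N : Type*} [DecidableEq ι] [DecidableEq κ] [AddCommMonoid N] [LinearOrder N]
    [IsOrderedCancelAddMonoid N] (A B : Finset ι) (f : ι → N) (cl : ι → κ)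
    (h1 : ∀ k, (B.filter (fun u => cl u = k)).card = (A.filter (fun u => cl u = k)).card)
    (h2 : ∀ u ∈ B, u ∉ A → ∀ w ∈ A, w ∉ B → cl u = cl w → f u < f w) (hne : B ≠ A) :
    ∑ u ∈ B, f u < ∑ u ∈ A, f u := by
  have key : ∀ S T : Finset ι, S.card = T.card → S.Nonempty →
      (∀ u ∈ S, ∀ w ∈ T, f u < f w) → ∑ u ∈ S, f u < ∑ u ∈ T, f u := by
    intro S T hc hS h
    let e := Finset.equivOfCardEq hc
    rw [← Finset.sum_coe_sort S, ← Finset.sum_coe_sort T, ← Equiv.sum_comp e]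
    haveI : Nonempty S := hS.to_subtype
    exact Finset.sum_lt_sum_of_nonempty Finset.univ_nonempty
      (fun x _ => h x x.2 (e x) (e x).2)
  have h3 : ∀ k, ((B \ A).filter (fun u => cl u = k)).card
      = ((A \ B).filter (fun u => cl u = k)).card := by
    intro k
    have e1 : (B \ A).filter (fun u => cl u = k)
        = (B.filter (fun u => cl u = k)) \ (A.filter (fun u => cl u = k)) := by
      ext u; simp; tauto
    have e2 : (A \ B).filter (fun u => cl u = k)
        = (A.filter (fun u => cl u = k)) \ (B.filter (fun u => cl u = k)) := by
      ext u; simp; tauto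
    rw [e1, e2]
    exact Finset.card_sdiff_comm (h1 k)
  have hBA : (B \ A).Nonempty := by
    rw [Finset.nonempty_iff_ne_empty]
    intro h0
    have hAB : A \ B = ∅ := by
      by_contra hh
      obtain ⟨w, hw⟩ := Finset.nonempty_iff_ne_empty.2 hh
      have := h3 (cl w)
      rw [h0] at this
      simp only [Finset.filter_empty, Finset.card_empty] at this
      have h4 := Finset.card_eq_zero.1 this.symm
      have : w ∈ (A \ B).filter (fun u => cl u = cl w) := by
        rw [Finset.mem_filter]; exact ⟨hw, rfl⟩
      rw [h4] at this
      simp at this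
    rw [Finset.sdiff_eq_empty_iff_subset] at h0 hAB
    exact hne (Finset.Subset.antisymm h0 hAB)
  have hlt : ∑ u ∈ B \ A, f u < ∑ u ∈ A \ B, f u := by
    have m1 : ∀ u ∈ B \ A, cl u ∈ (B \ A).image cl ∪ (A \ B).image cl := by
      intro u hu; exact Finset.mem_union_left _ (Finset.mem_image_of_mem _ hu)
    have m2 : ∀ u ∈ A \ B, cl u ∈ (B \ A).image cl ∪ (A \ B).image cl := by
      intro u hu; exact Finset.mem_union_right _ (Finset.mem_image_of_mem _ hu)
    rw [← Finset.sum_fiberwise_of_maps_to m1, ← Finset.sum_fiberwise_of_maps_to m2]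
    have hk : ∀ k, ((B \ A).filter (fun u => cl u = k)).Nonempty →
        ∑ u ∈ (B \ A).filter (fun u => cl u = k), f u
          < ∑ u ∈ (A \ B).filter (fun u => cl u = k), f u := by
      intro k hne
      refine key _ _ (h3 k) hne ?_
      intro u hu w hw
      simp only [Finset.mem_filter, Finset.mem_sdiff] at hu hw
      exact h2 u hu.1.1 hu.1.2 w hw.1.1 hw.1.2 (hu.2.trans hw.2.symm)
    apply Finset.sum_lt_sum
    · intro k _
      rcases ((B \ A).filter (fun u => cl u = k)).eq_empty_or_nonempty with h | h
      · have := h3 k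
        rw [h, Finset.card_empty] at this
        rw [h, Finset.card_eq_zero.1 this.symm]
      · exact (hk k h).le
    · obtain ⟨u, hu⟩ := hBA
      refine ⟨cl u, m1 u hu, hk _ ⟨u, ?_⟩⟩
      rw [Finset.mem_filter]; exact ⟨hu, rfl⟩
  rw [← Finset.sum_inter_add_sum_sdiff B A, ← Finset.sum_inter_add_sum_sdiff A B,
    Finset.inter_comm A B]
  exact (add_lt_add_iff_left _).2 hlt

lemma lexlt_iff (μ ν : X →₀ ℕ) :
    toLex μ < toLex ν ↔ ∃ x, (∀ y, y < x → μ y = ν y) ∧ μ x < ν x := Iff.rfl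

lemma revGT_iff (μ ν : X →₀ ℕ) : MonRevGT μ ν ↔ toLex μ < toLex ν := by
  rw [lexlt_iff]
  constructor
  · rintro ⟨x, h1, h2⟩; exact ⟨x, h2, h1⟩
  · rintro ⟨x, h1, h2⟩; exact ⟨x, h2, h1⟩

lemma degM_add (u v : X →₀ ℕ) : degM (u + v) = degM u + degM v := by
  simp [degM, Finset.sum_add_distrib]

lemma degC_add (c : X → ℕ) (i : ℕ) (u v : X →₀ ℕ) :
    degC c i (u + v) = degC c i u + degC c i v := by
  simp [degC, Finset.sum_add_distrib]

lemma degM_single (x : X) (k : ℕ) : degM (Finsupp.single x k) = k := by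
  simp [degM, Finsupp.single_apply]

lemma degC_single (c : X → ℕ) (i : ℕ) (x : X) (k : ℕ) :
    degC c i (Finsupp.single x k) = if c x = i then k else 0 := by
  simp only [degC, Finsupp.single_apply]
  rw [Finset.sum_ite_eq]
  simp

lemma degC_le_degM (c : X → ℕ) (i : ℕ) (u : X →₀ ℕ) : degC c i u ≤ degM u := by
  unfold degC degM
  exact Finset.sum_le_sum_of_subset (Finset.filter_subset _ _)

lemma le_degM (u : X →₀ ℕ) (x : X) : u x ≤ degM u := by
  unfold degM
  exact Finset.single_le_sum (f := fun x => u x) (fun _ _ => Nat.zero_le _) (Finset.mem_univ x)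

/-- Monomials supported on `P`, of degree `j`, with bounded `X_i`-degree. -/
def TT (c : X → ℕ) (i a : ℕ) (P : Finset X) (j : ℕ) (u : X →₀ ℕ) : Prop :=
  (∀ x, x ∉ P → u x = 0) ∧ degM u = j ∧ degC c i u ≤ a

/-- Shadow. -/
noncomputable def shd (A : Finset (X →₀ ℕ)) : Finset (X →₀ ℕ) :=
  A.biUnion fun u => u.support.image fun x => u - Finsupp.single x 1

lemma sub_add_single' (u : X →₀ ℕ) (x : X) (k : ℕ) (h : k ≤ u x) :
    u - Finsupp.single x k + Finsupp.single x k = u := by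
  ext y
  by_cases hy : x = y
  · subst hy; simp; omega
  · simp [Finsupp.single_apply, hy]

lemma mem_shd {A : Finset (X →₀ ℕ)} {v : X →₀ ℕ} :
    v ∈ shd A ↔ ∃ x, v + Finsupp.single x 1 ∈ A := by
  simp only [shd, Finset.mem_biUnion, Finset.mem_image, Finsupp.mem_support_iff]
  constructor
  · rintro ⟨u, hu, x, hx, rfl⟩
    exact ⟨x, by rwa [sub_add_single' u x 1 (by omega)]⟩
  · rintro ⟨x, hx⟩
    exact ⟨_, hx, x, by simp, by simp⟩

/-- Stable sets. -/
def Stb (P : Finset X) (A : Finset (X →₀ ℕ)) : Prop :=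
  ∀ x ∈ P, ∀ y ∈ P, x < y → ∀ u : X →₀ ℕ,
    u + Finsupp.single x 1 ∈ A → u + Finsupp.single y 1 ∈ A

/-- Initial sets. -/
def Ini (T : (X →₀ ℕ) → Prop) (L : Finset (X →₀ ℕ)) : Prop :=
  (∀ u ∈ L, T u) ∧ ∀ u ∈ L, ∀ w, T w → toLex w ≤ toLex u → w ∈ L

lemma Ini.nested {T : (X →₀ ℕ) → Prop} {L L' : Finset (X →₀ ℕ)} (h : Ini T L) (h' : Ini T L')
    (hc : L.card ≤ L'.card) : L ⊆ L' := by
  intro u hu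
  by_contra hn
  have : L' ⊂ L := by
    rw [Finset.ssubset_iff_of_subset]
    · exact ⟨u, hu, hn⟩
    · intro w hw
      refine h.2 u hu w (h'.1 w hw) ?_
      by_contra hlt
      exact hn (h'.2 w hw u (h.1 u hu) (not_le.1 hlt).le)
  have := Finset.card_lt_card this
  omega

lemma exists_ini (W : Finset (X →₀ ℕ)) (k : ℕ) (hk : k ≤ W.card) :
    ∃ L, Ini (fun u => u ∈ W) L ∧ L.card = k := by
  induction hn : W.card - k generalizing k with
  | zero =>
    refine ⟨W, ⟨fun u h => h, fun u _ w hw _ => hw⟩, by omega⟩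
  | succ n ih =>
    obtain ⟨L, hL, hc⟩ := ih (k + 1) (by omega) (by omega)
    have hne : L.Nonempty := Finset.card_pos.1 (by omega)
    obtain ⟨m, hm, hmax⟩ := Finset.exists_max_image L (fun u => toLex u) hne
    refine ⟨L.erase m, ⟨fun u hu => hL.1 u (Finset.mem_of_mem_erase hu), ?_⟩, ?_⟩
    · intro u hu w hw hle
      rw [Finset.mem_erase] at hu ⊢
      refine ⟨?_, hL.2 u hu.2 w hw hle⟩
      rintro rfl
      exact hu.1 (toLex.injective (le_antisymm (hmax u hu.2) hle))
    · rw [Finset.card_erase_of_mem hm]; omega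

open Classical in
/-- The finset of all `TT` monomials. -/
noncomputable def WT (c : X → ℕ) (i a : ℕ) (P : Finset X) (j : ℕ) : Finset (X →₀ ℕ) :=
  ((Finset.univ : Finset X).finsuppAntidiag j).filter (TT c i a P j)

lemma mem_WT {c : X → ℕ} {i a : ℕ} {P : Finset X} {j : ℕ} {u : X →₀ ℕ} :
    u ∈ WT c i a P j ↔ TT c i a P j u := by
  classical
  unfold WT
  rw [Finset.mem_filter, Finset.mem_finsuppAntidiag]
  constructor
  · exact fun h => h.2
  · intro h
    exact ⟨⟨h.2.1, Finset.subset_univ _⟩, h⟩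

lemma exists_ini_TT (c : X → ℕ) (i a : ℕ) (P : Finset X) (j : ℕ) (A : Finset (X →₀ ℕ))
    (hA : ∀ u ∈ A, TT c i a P j u) : ∃ L, Ini (TT c i a P j) L ∧ L.card = A.card := by
  obtain ⟨L, hL, hc⟩ := exists_ini (WT c i a P j) A.card
    (Finset.card_le_card (fun u hu => mem_WT.2 (hA u hu)))
  refine ⟨L, ⟨fun u hu => mem_WT.1 (hL.1 u hu), fun u hu w hw => hL.2 u hu w (mem_WT.2 hw)⟩, hc⟩

lemma single_lex {x y : X} (h : x ≤ y) (k : ℕ) :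
    toLex (Finsupp.single y k) ≤ toLex (Finsupp.single x k) := by
  rcases h.eq_or_lt with rfl | h
  · exact le_rfl
  rcases Nat.eq_zero_or_pos k with rfl | hk
  · simp
  · apply le_of_lt
    rw [lexlt_iff]
    refine ⟨x, ?_, ?_⟩
    · intro z hz
      have h1 : y ≠ z := fun e => by subst e; exact absurd hz (not_lt.2 h.le)
      simp [Finsupp.single_apply, h1, hz.ne']
    · simp [Finsupp.single_apply, h.ne', hk]

lemma add_lex_le {u v u' v' : X →₀ ℕ} (h : toLex u ≤ toLex v) (h' : toLex u' ≤ toLex v') :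
    toLex (u + u') ≤ toLex (v + v') := by
  rw [toLex_add, toLex_add]; exact add_le_add h h'

lemma TT_top_add {c : X → ℕ} {i a : ℕ} (hi : 1 ≤ i) (horder : ∀ x y : X, c x < c y → y < x)
    {P : Finset X} (hP : ∀ x ∈ P, c x = 0 ∨ c x = i) {q : X} (hq : q ∈ P)
    (hmax : ∀ x ∈ P, x ≤ q) {j k : ℕ} {u v : X →₀ ℕ} (hu : TT c i a P j u)
    (hv : TT c i a P (j + k) v) : TT c i a P (j + k) (u + Finsupp.single q k) := by
  refine ⟨?_, ?_, ?_⟩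
  · intro x hx
    have : q ≠ x := fun e => hx (e ▸ hq)
    simp [Finsupp.single_apply, this, hu.1 x hx]
  · rw [degM_add, degM_single, hu.2.1]
  · rw [degC_add, degC_single]
    split_ifs with hc
    · have h1 : degC c i v = degM v := by
        unfold degC degM
        apply Finset.sum_subset (Finset.filter_subset _ _)
        intro x _ hx
        apply hv.1
        intro hxP
        rcases hP x hxP with h0 | h0
        · have := horder x q (by omega)
          exact absurd (hmax x hxP) (not_le.2 this)
        · exact hx (by simp [h0])
      have h2 := degC_le_degM c i u
      have h3 := hv.2.1
      have h4 := hv.2.2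
      have h5 := hu.2.1
      omega
    · simpa using hu.2.2

lemma shd_ini {c : X → ℕ} {i a : ℕ} (hi : 1 ≤ i) (horder : ∀ x y : X, c x < c y → y < x)
    {P : Finset X} (hP : ∀ x ∈ P, c x = 0 ∨ c x = i) {n : ℕ} {L : Finset (X →₀ ℕ)}
    (hL : Ini (TT c i a P (n + 1)) L) : Ini (TT c i a P n) (shd L) := by
  have hx0 : ∀ (u : X →₀ ℕ) x, u + Finsupp.single x 1 ∈ L → x ∈ P := by
    intro u x h
    by_contra hx
    have := (hL.1 _ h).1 x hx
    simp at this
  constructor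
  · intro u hu
    obtain ⟨x, hx⟩ := mem_shd.1 hu
    obtain ⟨h1, h2, h3⟩ := hL.1 _ hx
    rw [degM_add, degM_single] at h2
    rw [degC_add] at h3
    refine ⟨?_, by omega, by omega⟩
    intro y hy
    have := h1 y hy
    simp only [Finsupp.add_apply] at this
    omega
  · intro u hu w hw hle
    obtain ⟨x, hx⟩ := mem_shd.1 hu
    have hxP := hx0 u x hx
    obtain ⟨p, hp, hmax⟩ := Finset.exists_max_image P (fun x => x) ⟨x, hxP⟩
    rw [mem_shd]
    refine ⟨p, hL.2 _ hx _ (TT_top_add hi horder hP hp hmax hw (hL.1 _ hx)) ?_⟩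
    exact add_lex_le hle (single_lex (hmax x hxP) 1)

lemma ini_stb {c : X → ℕ} {i a : ℕ} (hi : 1 ≤ i) (horder : ∀ x y : X, c x < c y → y < x)
    {P : Finset X} (hP : ∀ x ∈ P, c x = 0 ∨ c x = i) {n : ℕ} {L : Finset (X →₀ ℕ)}
    (hL : Ini (TT c i a P n) L) : Stb P L := by
  intro x hx y hy hxy u hu
  refine hL.2 _ hu _ ?_ (add_lex_le le_rfl (single_lex hxy.le 1))
  obtain ⟨h1, h2, h3⟩ := hL.1 _ hu
  rw [degM_add, degM_single] at h2
  rw [degC_add, degC_single] at h3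
  refine ⟨?_, by rw [degM_add, degM_single]; omega, ?_⟩
  · intro z hz
    have := h1 z hz
    have hne : y ≠ z := fun e => hz (e ▸ hy)
    simp only [Finsupp.add_apply] at this
    simp [Finsupp.single_apply, hne]
    omega
  · rw [degC_add, degC_single]
    rcases hP y hy with h0 | h0
    · rw [if_neg (by omega)]; omega
    · rw [if_pos h0]
      rcases hP x hx with h4 | h4
      · have := horder x y (by omega)
        exact absurd this (not_lt.2 hxy.le)
      · rw [if_pos h4] at h3; omega

lemma shd_card {P : Finset X} {A : Finset (X →₀ ℕ)} {p : X} (hp : p ∈ P)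
    (hmax : ∀ x ∈ P, x ≤ p) (hA : Stb P A) (hAP : ∀ u ∈ A, ∀ x, x ∉ P → u x = 0) :
    (shd A).card + (A.filter (fun u => u p = 0)).card = A.card := by
  have h1 : (shd A).card = (A.filter (fun u => ¬ u p = 0)).card := by
    have : A.filter (fun u => ¬ u p = 0) = (shd A).image (fun u => u + Finsupp.single p 1) := by
      ext u
      simp only [Finset.mem_filter, Finset.mem_image, mem_shd]
      constructor
      · rintro ⟨hu, h0⟩
        exact ⟨u - Finsupp.single p 1, ⟨p, by rwa [sub_add_single' u p 1 (by omega)]⟩,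
          sub_add_single' u p 1 (by omega)⟩
      · rintro ⟨v, ⟨x, hx⟩, rfl⟩
        refine ⟨?_, by simp⟩
        have hxP : x ∈ P := by
          by_contra hxP
          have := hAP _ hx x hxP
          simp at this
        rcases (hmax x hxP).eq_or_lt with rfl | hlt
        · exact hx
        · exact hA x hxP p hp hlt v hx
    rw [this, Finset.card_image_of_injective _ (add_left_injective _)]
  rw [h1, add_comm]
  exact Finset.card_filter_add_card_filter_not _

/-- Slices. -/
noncomputable def sl (A : Finset (X →₀ ℕ)) (p : X) (k : ℕ) : Finset (X →₀ ℕ) :=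
  (A.filter (fun u => u p = k)).image (fun u => u.erase p)

lemma mem_sl {A : Finset (X →₀ ℕ)} {p : X} {k : ℕ} {v : X →₀ ℕ} :
    v ∈ sl A p k ↔ v p = 0 ∧ v + Finsupp.single p k ∈ A := by
  simp only [sl, Finset.mem_image, Finset.mem_filter]
  constructor
  · rintro ⟨u, ⟨hu, rfl⟩, rfl⟩
    refine ⟨by simp, by rwa [Finsupp.erase_add_single]⟩
  · rintro ⟨h0, h⟩
    refine ⟨_, ⟨h, by simp [h0]⟩, ?_⟩
    ext y
    by_cases hy : y = p
    · subst hy; simp [h0]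
    · simp [Finsupp.erase_ne hy, Finsupp.single_apply, Ne.symm hy]

lemma sl_card {A : Finset (X →₀ ℕ)} {p : X} {j : ℕ} (h : ∀ u ∈ A, degM u = j) :
    A.card = ∑ k ∈ Finset.range (j + 1), (sl A p k).card := by
  have : ∀ u ∈ A, u p ∈ Finset.range (j + 1) := by
    intro u hu
    have := le_degM u p
    rw [h u hu] at this
    simp; omega
  rw [Finset.card_eq_sum_card_fiberwise this]
  apply Finset.sum_congr rfl
  intro k _
  unfold sl
  rw [Finset.card_image_of_injOn]
  intro u hu v hv huv
  simp only [Finset.coe_filter, Set.mem_ofPred_eq] at hu hv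
  rw [← Finsupp.erase_add_single p u, ← Finsupp.erase_add_single p v, hu.2, hv.2]
  exact congrArg (· + _) huv

theorem mac_stb {c : X → ℕ} {i a : ℕ} (hi : 1 ≤ i) (horder : ∀ x y : X, c x < c y → y < x)
    (P : Finset X) : (∀ x ∈ P, c x = 0 ∨ c x = i) → ∀ (j : ℕ) (A L : Finset (X →₀ ℕ)),
    (∀ u ∈ A, TT c i a P j u) → Stb P A → Ini (TT c i a P j) L → L.card = A.card →
    (shd L).card ≤ (shd A).card := by
  induction P using Finset.induction_on_max with
  | empty =>
    intro _ j A L _ _ hL _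
    have : shd L = ∅ := by
      by_contra hne
      obtain ⟨v, hv⟩ := Finset.nonempty_iff_ne_empty.2 hne
      obtain ⟨x, hx⟩ := mem_shd.1 hv
      have := (hL.1 _ hx).1 x (by simp)
      simp at this
    rw [this]; simp
  | insert p s hps ih =>
    intro hP j A L hA hAs hL hcard
    have hPs : ∀ x ∈ s, c x = 0 ∨ c x = i := fun x hx => hP x (Finset.mem_insert_of_mem hx)
    have ih := ih hPs
    have hpP : p ∈ insert p s := Finset.mem_insert_self _ _
    have hps' : p ∉ s := fun h => lt_irrefl _ (hps p h)
    have hmax : ∀ x ∈ insert p s, x ≤ p := by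
      intro x hx
      rcases Finset.mem_insert.1 hx with rfl | h
      · exact le_rfl
      · exact (hps x h).le
    have c1 := shd_card hpP hmax hAs (fun u hu => (hA u hu).1)
    have c2 := shd_card hpP hmax (ini_stb hi horder hP hL) (fun u hu => (hL.1 u hu).1)
    by_contra hcon
    have hlt : (L.filter (fun u => u p = 0)).card < (A.filter (fun u => u p = 0)).card := by omega
    -- slices
    have hslT : ∀ l, ∀ u ∈ sl A p l, l ≤ j ∧ TT c i a s (j - l) u := by
      intro l u hu
      obtain ⟨h0, h1⟩ := mem_sl.1 hu
      obtain ⟨h2, h3, h4⟩ := hA _ h1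
      rw [degM_add, degM_single] at h3
      rw [degC_add] at h4
      refine ⟨by omega, ?_, by omega, by omega⟩
      intro x hx
      by_cases hxp : x = p
      · rw [hxp]; exact h0
      · have := h2 x (by simp [hxp, hx])
        simp only [Finsupp.add_apply] at this
        omega
    choose B hB hBc using fun l =>
      exists_ini_TT c i a s (j - l) (sl A p l) (fun u hu => (hslT l u hu).2)
    have hslS : ∀ l, Stb s (sl A p l) := by
      intro l x hx y hy hxy u hu
      rw [mem_sl] at hu ⊢
      obtain ⟨h0, h1⟩ := hu
      have hyp : y ≠ p := fun e => hps' (e ▸ hy)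
      have hxp : x ≠ p := fun e => hps' (e ▸ hx)
      refine ⟨?_, ?_⟩
      · simp only [Finsupp.add_apply, Finsupp.single_apply, hxp, hyp, if_false] at h0 ⊢
        exact h0
      · rw [add_right_comm] at h1 ⊢
        exact hAs x (Finset.mem_insert_of_mem hx) y (Finset.mem_insert_of_mem hy) hxy _ h1
    have hstep : ∀ l, l < j → shd (B l) ⊆ B (l + 1) := by
      intro l hl
      have e1 : j - l = (j - (l + 1)) + 1 := by omega
      have hBl := hB l
      have hB1 : Ini (TT c i a s (j - (l + 1))) (shd (B l)) := by
        rw [e1] at hBl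
        exact shd_ini hi horder hPs hBl
      refine hB1.nested (hB (l + 1)) ?_
      calc (shd (B l)).card ≤ (shd (sl A p l)).card :=
            ih (j - l) (sl A p l) (B l) (fun u hu => (hslT l u hu).2) (hslS l) (hB l) (hBc l)
        _ ≤ (sl A p (l + 1)).card := by
            apply Finset.card_le_card
            intro u hu
            obtain ⟨x, hx⟩ := mem_shd.1 hu
            have hxs : x ∈ s := by
              by_contra hxs
              have := (hslT l _ hx).2.1 x hxs
              simp at this
            rw [mem_sl] at hx ⊢
            have h0 := hx.1
            simp only [Finsupp.add_apply] at h0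
            refine ⟨by omega, ?_⟩
            have h1 := hx.2
            rw [add_right_comm] at h1
            have := hAs x (Finset.mem_insert_of_mem hxs) p hpP (hps x hxs) _ h1
            rwa [add_assoc, ← Finsupp.single_add] at this
        _ = (B (l + 1)).card := (hBc _).symm
    -- pick v
    obtain ⟨v, hvB, hvL⟩ : ∃ v ∈ B 0, v ∉ L.filter (fun u : X →₀ ℕ => u p = 0) := by
      by_contra hno
      push Not at hno
      have h1 := Finset.card_le_card (show B 0 ⊆ L.filter (fun u => u p = 0) from hno)
      have h2 : (sl A p 0).card = (A.filter (fun u => u p = 0)).card := by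
        congr 1
        ext u
        rw [mem_sl, Finset.mem_filter]
        simp [and_comm]
      rw [hBc, h2] at h1
      omega
    have hvT : TT c i a s j v := by simpa using (hB 0).1 v hvB
    have hvp : v p = 0 := hvT.1 p hps'
    have hvL' : v ∉ L := fun h => hvL (Finset.mem_filter.2 ⟨h, hvp⟩)
    have hvT' : TT c i a (insert p s) j v :=
      ⟨fun x hx => hvT.1 x (fun h => hx (Finset.mem_insert_of_mem h)), hvT.2⟩
    let D := (WT c i a (insert p s) j).filter (fun w => toLex w ≤ toLex v)
    have hLD : L ⊂ D := by
      rw [Finset.ssubset_iff_of_subset]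
      · exact ⟨v, Finset.mem_filter.2 ⟨mem_WT.2 hvT', le_rfl⟩, hvL'⟩
      · intro u hu
        refine Finset.mem_filter.2 ⟨mem_WT.2 (hL.1 u hu), ?_⟩
        by_contra hnle
        exact hvL' (hL.2 u hu v hvT' (not_le.1 hnle).le)
    have hDk : ∀ k, sl D p k ⊆ B k := by
      intro k w hw
      obtain ⟨hw0, hwD⟩ := mem_sl.1 hw
      obtain ⟨hwT, hwle⟩ := Finset.mem_filter.1 hwD
      rw [mem_WT] at hwT
      obtain ⟨t1, t2, t3⟩ := hwT
      rw [degM_add, degM_single] at t2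
      rw [degC_add] at t3
      have hwTs : TT c i a s (j - k) w := by
        refine ⟨?_, by omega, by omega⟩
        intro x hx
        by_cases hxp : x = p
        · rw [hxp]; exact hw0
        · have := t1 x (by simp [hxp, hx])
          simp only [Finsupp.add_apply] at this
          omega
      rcases Nat.eq_zero_or_pos k with rfl | hk
      · refine (hB 0).2 v hvB w hwTs ?_
        simpa using hwle
      · have hsne : s.Nonempty := by
          rw [Finset.nonempty_iff_ne_empty]
          rintro rfl
          have h2 := hvT.2.1
          have : degM v = 0 := by
            unfold degM
            apply Finset.sum_eq_zero
            intro x _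
            exact hvT.1 x (by simp)
          omega
        obtain ⟨q, hq, hqmax⟩ := Finset.exists_max_image s (fun x => x) hsne
        have e2 : j - k + k = j := by omega
        have hw'T : TT c i a s j (w + Finsupp.single q k) := by
          have := TT_top_add hi horder hPs hq hqmax (k := k) hwTs (v := v) (by rwa [e2])
          rwa [e2] at this
        have hw'le : toLex (w + Finsupp.single q k) ≤ toLex v := by
          by_contra hn
          rw [not_le, lexlt_iff] at hn
          obtain ⟨x, hx1, hx2⟩ := hn
          rcases lt_trichotomy x q with hxq | rfl | hxq
          · apply absurd hwle
            rw [not_le, lexlt_iff]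
            refine ⟨x, ?_, ?_⟩
            · intro y hy
              rw [hx1 y hy]
              have n1 : q ≠ y := (hy.trans hxq).ne'
              have n2 : p ≠ y := (hy.trans (hxq.trans (hps q hq))).ne'
              simp [Finsupp.single_apply, n1, n2]
            · have n1 : q ≠ x := hxq.ne'
              have n2 : p ≠ x := (hxq.trans (hps q hq)).ne'
              simpa [Finsupp.single_apply, n1, n2] using hx2
          · have : degM v < degM (w + Finsupp.single x k) := by
              unfold degM
              apply Finset.sum_lt_sum
              · intro y _
                rcases lt_trichotomy y x with h | rfl | h
                · exact (hx1 y h).le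
                · exact hx2.le
                · rw [hvT.1 y (fun hy => absurd (hqmax y hy) (not_le.2 h))]
                  exact Nat.zero_le _
              · exact ⟨x, Finset.mem_univ _, hx2⟩
            rw [hvT.2.1, hw'T.2.1] at this
            exact lt_irrefl _ this
          · have := hw'T.1 x (fun hy => absurd (hqmax x hy) (not_le.2 hxq))
            omega
        have hw'B := (hB 0).2 v hvB _ hw'T hw'le
        have hind : ∀ l, l ≤ k → w + Finsupp.single q (k - l) ∈ B l := by
          intro l
          induction l with
          | zero => intro _; simpa using hw'B
          | succ l ihl =>
            intro hl
            apply hstep l (by omega)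
            rw [mem_shd]
            refine ⟨q, ?_⟩
            rw [add_assoc, ← Finsupp.single_add, show k - (l + 1) + 1 = k - l by omega]
            exact ihl (by omega)
        simpa using hind k le_rfl
    have hDc := sl_card (A := D) (p := p) (j := j)
      (fun u hu => (mem_WT.1 (Finset.mem_filter.1 hu).1).2.1)
    have hAc := sl_card (A := A) (p := p) (j := j) (fun u hu => (hA u hu).2.1)
    have : D.card ≤ A.card := by
      rw [hDc, hAc]
      apply Finset.sum_le_sum
      intro k _
      rw [← hBc k]
      exact Finset.card_le_card (hDk k)
    have := Finset.card_lt_card hLD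
    omega

/-- Remove the variables `x` and `y`. -/
noncomputable def ky (x y : X) (u : X →₀ ℕ) : X →₀ ℕ := (u.erase x).erase y

lemma ky_eq_iff {x y : X} {u v : X →₀ ℕ} :
    ky x y u = ky x y v ↔ ∀ z, z ≠ x → z ≠ y → u z = v z := by
  unfold ky
  constructor
  · intro h z hx hy
    have := DFunLike.congr_fun h z
    simpa [Finsupp.erase_ne, hx, hy] using this
  · intro h
    ext z
    by_cases hy : z = y
    · subst hy; simp
    · by_cases hx : z = x
      · subst hx; simp [Finsupp.erase_ne hy]
      · simp [Finsupp.erase_ne, hx, hy, h z hx hy]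

lemma ky_decomp {x y : X} (hxy : x ≠ y) (u : X →₀ ℕ) :
    u = ky x y u + Finsupp.single x (u x) + Finsupp.single y (u y) := by
  unfold ky
  ext z
  by_cases hy : z = y
  · subst hy; simp [Finsupp.single_apply, hxy]
  · by_cases hx : z = x
    · subst hx; simp [Finsupp.erase_ne, hy, Finsupp.single_apply, Ne.symm hxy]
    · simp [Finsupp.erase_ne, hy, hx, Finsupp.single_apply, Ne.symm hx, Ne.symm hy]

lemma ky_sum {x y : X} (hxy : x ≠ y) {u v : X →₀ ℕ} (h : ky x y u = ky x y v)
    (hd : degM u = degM v) : u x + u y = v x + v y := by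
  have h1 := congrArg degM (ky_decomp hxy u)
  have h2 := congrArg degM (ky_decomp hxy v)
  rw [degM_add, degM_add, degM_single, degM_single] at h1 h2
  rw [h] at h1
  omega

lemma ky_ext {x y : X} (hxy : x ≠ y) {u v : X →₀ ℕ} (h : ky x y u = ky x y v)
    (hd : degM u = degM v) (hx : u x = v x) : u = v := by
  have := ky_sum hxy h hd
  rw [ky_decomp hxy u, ky_decomp hxy v, h, hx, show u y = v y by omega]

/-- Class of `A`. -/
noncomputable def cls (x y : X) (A : Finset (X →₀ ℕ)) (κ : X →₀ ℕ) : Finset (X →₀ ℕ) :=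
  A.filter (fun v => ky x y v = κ)

/-- Two-variable compression. -/
noncomputable def cmp2 (x y : X) (n : ℕ) (A : Finset (X →₀ ℕ)) : Finset (X →₀ ℕ) :=
  ((Finset.univ : Finset X).finsuppAntidiag n).filter
    (fun u => u x < (cls x y A (ky x y u)).card)

lemma mem_cmp2 {x y : X} {n : ℕ} {A : Finset (X →₀ ℕ)} {u : X →₀ ℕ} :
    u ∈ cmp2 x y n A ↔ degM u = n ∧ u x < (cls x y A (ky x y u)).card := by
  unfold cmp2
  rw [Finset.mem_filter, Finset.mem_finsuppAntidiag]
  simp [degM]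

lemma mem_cls {x y : X} {A : Finset (X →₀ ℕ)} {κ v : X →₀ ℕ} :
    v ∈ cls x y A κ ↔ v ∈ A ∧ ky x y v = κ := Finset.mem_filter

lemma cls_inj {x y : X} (hxy : x ≠ y) {n : ℕ} {A : Finset (X →₀ ℕ)} (hA : ∀ u ∈ A, degM u = n)
    (κ : X →₀ ℕ) : Set.InjOn (fun v : X →₀ ℕ => v x) (cls x y A κ) := by
  intro u hu v hv h
  have hu := mem_cls.1 hu
  have hv := mem_cls.1 hv
  exact ky_ext hxy (hu.2.trans hv.2.symm) ((hA u hu.1).trans (hA v hv.1).symm) h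

lemma cmp2_cls_card {x y : X} (hxy : x ≠ y) {n : ℕ} {A : Finset (X →₀ ℕ)}
    (hA : ∀ u ∈ A, degM u = n) (κ : X →₀ ℕ) :
    (cls x y (cmp2 x y n A) κ).card = (cls x y A κ).card := by
  rcases (cls x y A κ).eq_empty_or_nonempty with h0 | ⟨v0, hv0⟩
  · rw [h0]
    have : cls x y (cmp2 x y n A) κ = ∅ := by
      by_contra hne
      obtain ⟨u, hu⟩ := Finset.nonempty_iff_ne_empty.2 hne
      obtain ⟨h1, h2⟩ := mem_cls.1 hu
      have := (mem_cmp2.1 h1).2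
      rw [h2, h0] at this
      simp at this
    rw [this]
  · have hC : ∀ u ∈ cmp2 x y n A, degM u = n := fun u hu => (mem_cmp2.1 hu).1
    have hv0' := mem_cls.1 hv0
    have hle : (cls x y A κ).card ≤ v0 x + v0 y + 1 := by
      rw [← Finset.card_image_of_injOn (cls_inj hxy hA κ), ← Finset.card_range (v0 x + v0 y + 1)]
      apply Finset.card_le_card
      intro q hq
      obtain ⟨v, hv, rfl⟩ := Finset.mem_image.1 hq
      have hv := mem_cls.1 hv
      have := ky_sum hxy (hv.2.trans hv0'.2.symm) ((hA v hv.1).trans (hA v0 hv0'.1).symm)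
      simp only [Finset.mem_range]
      omega
    rw [← Finset.card_image_of_injOn (cls_inj hxy hC κ)]
    have : (cls x y (cmp2 x y n A) κ).image (fun v : X →₀ ℕ => v x)
        = Finset.range (cls x y A κ).card := by
      ext q
      simp only [Finset.mem_image, Finset.mem_range]
      constructor
      · rintro ⟨u, hu, rfl⟩
        obtain ⟨h1, h2⟩ := mem_cls.1 hu
        have := (mem_cmp2.1 h1).2
        rwa [h2] at this
      · intro hq
        have hκx : κ x = 0 := by rw [← hv0'.2]; simp [ky, Finsupp.erase_ne hxy]
        have hκy : κ y = 0 := by rw [← hv0'.2]; simp [ky]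
        have hk : ky x y (κ + Finsupp.single x q + Finsupp.single y (v0 x + v0 y - q)) = κ := by
          rw [← hv0'.2, ky_eq_iff.2]
          intro z hzx hzy
          simp [Finsupp.single_apply, Ne.symm hzx, Ne.symm hzy, ky, Finsupp.erase_ne, hzx, hzy]
        have hx : (κ + Finsupp.single x q + Finsupp.single y (v0 x + v0 y - q)) x = q := by
          simp [Finsupp.single_apply, hκx, Ne.symm hxy]
        refine ⟨κ + Finsupp.single x q + Finsupp.single y (v0 x + v0 y - q), ?_, hx⟩
        rw [mem_cls, mem_cmp2, hk, hx]
        refine ⟨⟨?_, hq⟩, rfl⟩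
        have h1 := congrArg degM (ky_decomp hxy v0)
        rw [hA v0 hv0'.1, hv0'.2] at h1
        rw [degM_add, degM_add, degM_single, degM_single] at h1 ⊢
        omega
    rw [this, Finset.card_range]

lemma exists_ge_of_lt_card {Q : Finset ℕ} {t : ℕ} (h : t < Q.card) : ∃ q ∈ Q, t ≤ q := by
  by_contra hn
  push Not at hn
  have : Q ⊆ Finset.range t := fun q hq => Finset.mem_range.2 (hn q hq)
  have := Finset.card_le_card this
  simp at this
  omega

lemma nat_shadow {Q R : Finset ℕ} {e t : ℕ} (hQ : ∀ q ∈ Q, q ≤ e)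
    (h1 : ∀ q ∈ Q, q < e → q ∈ R) (h2 : ∀ q ∈ Q, 0 < q → q - 1 ∈ R)
    (ht : t < Q.card) (hte : t < e) : t < R.card := by
  by_cases hfull : ∃ q0, q0 ≤ e ∧ q0 ∉ Q
  · obtain ⟨q0, hq0, hq0'⟩ := hfull
    refine lt_of_lt_of_le ht ?_
    apply Finset.card_le_card_of_injOn (fun q => if q < q0 then q else q - 1)
    · intro q hq
      have hne : q ≠ q0 := fun e => hq0' (e ▸ hq)
      have := hQ q hq
      dsimp only
      split_ifs with h
      · exact h1 q hq (by omega)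
      · exact h2 q hq (by omega)
    · intro q hq r hr h
      have hne : q ≠ q0 := fun e => hq0' (e ▸ hq)
      have hne' : r ≠ q0 := fun e => hq0' (e ▸ hr)
      dsimp only at h
      split_ifs at h <;> omega
  · push Not at hfull
    refine lt_of_lt_of_le hte ?_
    rw [← Finset.card_range e]
    apply Finset.card_le_card
    intro q hq
    have := Finset.mem_range.1 hq
    exact h1 q (hfull q this.le) this

lemma shd_cmp2 {x y : X} (hxy : x ≠ y) {n : ℕ} {A : Finset (X →₀ ℕ)}
    (hA : ∀ u ∈ A, degM u = n + 1) : shd (cmp2 x y (n + 1) A) ⊆ cmp2 x y n (shd A) := by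
  have hS : ∀ u ∈ shd A, degM u = n := by
    intro u hu
    obtain ⟨z, hz⟩ := mem_shd.1 hu
    have := hA _ hz
    rw [degM_add, degM_single] at this
    omega
  intro u hu
  obtain ⟨z, hz⟩ := mem_shd.1 hu
  rw [mem_cmp2] at hz ⊢
  obtain ⟨hd, hlt⟩ := hz
  have hd' : degM u = n := by rw [degM_add, degM_single] at hd; omega
  refine ⟨hd', ?_⟩
  by_cases hzxy : z ≠ x ∧ z ≠ y
  · obtain ⟨hzx, hzy⟩ := hzxy
    have e1 : (u + Finsupp.single z 1 : X →₀ ℕ) x = u x := by simp [Finsupp.single_apply, hzx]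
    rw [e1] at hlt
    refine lt_of_lt_of_le hlt ?_
    have hvz : ∀ v ∈ cls x y A (ky x y (u + Finsupp.single z 1)), 1 ≤ v z := by
      intro v hv
      have := ky_eq_iff.1 (mem_cls.1 hv).2 z hzx hzy
      simp at this
      omega
    apply Finset.card_le_card_of_injOn (fun v => v - Finsupp.single z 1)
    · intro v hv
      have hv1 := hvz v hv
      have hv' := mem_cls.1 hv
      rw [Finset.mem_coe, mem_cls, mem_shd]
      refine ⟨⟨z, by rw [sub_add_single' v z 1 hv1]; exact hv'.1⟩, ?_⟩
      rw [ky_eq_iff]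
      intro w hwx hwy
      have := ky_eq_iff.1 hv'.2 w hwx hwy
      simp only [Finsupp.add_apply, Finsupp.coe_tsub, Pi.sub_apply] at this ⊢
      omega
    · intro v hv w hw h
      dsimp only at h
      rw [← sub_add_single' v z 1 (hvz v hv), ← sub_add_single' w z 1 (hvz w hw), h]
  · have hz' : z = x ∨ z = y := by tauto
    set w := u + Finsupp.single z 1 with hw
    have hkw : ky x y w = ky x y u := by
      rw [ky_eq_iff]
      intro t htx hty
      have : z ≠ t := by rcases hz' with rfl | rfl <;> [exact Ne.symm htx; exact Ne.symm hty]
      simp [hw, Finsupp.single_apply, this]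
    have hsum : w x + w y = u x + u y + 1 := by
      rcases hz' with rfl | rfl
      · simp [hw, Finsupp.single_apply, hxy]; omega
      · simp [hw, Finsupp.single_apply, Ne.symm hxy]; omega
    have hux : u x ≤ w x := by simp [hw]
    rw [hkw] at hlt
    rw [← Finset.card_image_of_injOn (cls_inj hxy hA _)] at hlt
    rw [← Finset.card_image_of_injOn (cls_inj hxy hS _)]
    have hvsum : ∀ v ∈ cls x y A (ky x y u), v x + v y = w x + w y := by
      intro v hv
      have hv' := mem_cls.1 hv
      exact ky_sum hxy (hv'.2.trans hkw.symm) ((hA v hv'.1).trans hd.symm)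
    have hdrop : ∀ v ∈ cls x y A (ky x y u), ∀ t, t = x ∨ t = y → 1 ≤ v t →
        v - Finsupp.single t 1 ∈ cls x y (shd A) (ky x y u) := by
      intro v hv t ht h1
      have hv' := mem_cls.1 hv
      rw [mem_cls, mem_shd]
      refine ⟨⟨t, by rw [sub_add_single' v t 1 h1]; exact hv'.1⟩, ?_⟩
      rw [← hv'.2, ky_eq_iff]
      intro r hrx hry
      have : t ≠ r := by rcases ht with rfl | rfl <;> [exact Ne.symm hrx; exact Ne.symm hry]
      simp [Finsupp.single_apply, this]
    refine nat_shadow (e := w x + w y)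
      (Q := (cls x y A (ky x y u)).image (fun v : X →₀ ℕ => v x)) ?_ ?_ ?_
      (lt_of_le_of_lt hux hlt) (by omega)
    · intro q hq
      obtain ⟨v, hv, rfl⟩ := Finset.mem_image.1 hq
      have := hvsum v hv
      omega
    · intro q hq hqe
      obtain ⟨v, hv, rfl⟩ := Finset.mem_image.1 hq
      have := hvsum v hv
      refine Finset.mem_image.2 ⟨_, hdrop v hv y (Or.inr rfl) (by omega), ?_⟩
      simp [Finsupp.single_apply, Ne.symm hxy]
    · intro q hq hq0
      obtain ⟨v, hv, rfl⟩ := Finset.mem_image.1 hq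
      refine Finset.mem_image.2 ⟨_, hdrop v hv x (Or.inl rfl) (by omega), ?_⟩
      simp

lemma card_of_classes {ι κ : Type*} [DecidableEq κ] {A B : Finset ι} (cl : ι → κ)
    (h1 : ∀ k, (B.filter (fun u => cl u = k)).card = (A.filter (fun u => cl u = k)).card) :
    B.card = A.card := by
  have m1 : ∀ u ∈ B, cl u ∈ B.image cl ∪ A.image cl := by
    intro u hu; exact Finset.mem_union_left _ (Finset.mem_image_of_mem _ hu)
  have m2 : ∀ u ∈ A, cl u ∈ B.image cl ∪ A.image cl := by
    intro u hu; exact Finset.mem_union_right _ (Finset.mem_image_of_mem _ hu)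
  rw [Finset.card_eq_sum_card_fiberwise m1, Finset.card_eq_sum_card_fiberwise m2]
  exact Finset.sum_congr rfl (fun k _ => h1 k)

lemma cmp2_card {x y : X} (hxy : x ≠ y) {n : ℕ} {A : Finset (X →₀ ℕ)}
    (hA : ∀ u ∈ A, degM u = n) : (cmp2 x y n A).card = A.card :=
  card_of_classes (ky x y) (cmp2_cls_card hxy hA)

lemma cmp2_TT {c : X → ℕ} {i a : ℕ} (hi : 1 ≤ i) (horder : ∀ x y : X, c x < c y → y < x)
    {P : Finset X} (hP : ∀ x ∈ P, c x = 0 ∨ c x = i) {x y : X} (hx : x ∈ P) (hy : y ∈ P)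
    (hxy : x < y) {n : ℕ} {A : Finset (X →₀ ℕ)} (hA : ∀ u ∈ A, TT c i a P n u) :
    ∀ u ∈ cmp2 x y n A, TT c i a P n u := by
  intro u hu
  obtain ⟨hd, hlt⟩ := mem_cmp2.1 hu
  rw [← Finset.card_image_of_injOn (cls_inj hxy.ne (fun u hu => (hA u hu).2.1) _)] at hlt
  obtain ⟨q, hq, hle⟩ := exists_ge_of_lt_card hlt
  obtain ⟨v, hv, rfl⟩ := Finset.mem_image.1 hq
  obtain ⟨hvA, hvk⟩ := mem_cls.1 hv
  obtain ⟨h1, h2, h3⟩ := hA v hvA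
  refine ⟨?_, hd, ?_⟩
  · intro z hz
    have hzx : z ≠ x := fun e => hz (e ▸ hx)
    have hzy : z ≠ y := fun e => hz (e ▸ hy)
    rw [← ky_eq_iff.1 hvk z hzx hzy]
    exact h1 z hz
  · have hs := ky_sum hxy.ne hvk (h2.trans hd.symm)
    have d1 := congrArg (degC c i) (ky_decomp hxy.ne u)
    have d2 := congrArg (degC c i) (ky_decomp hxy.ne v)
    rw [degC_add, degC_add, degC_single, degC_single] at d1 d2
    rw [hvk] at d2
    rcases hP x hx with hx0 | hx0 <;> rcases hP y hy with hy0 | hy0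
    · rw [hx0, hy0] at d1 d2
      rw [if_neg (by omega), if_neg (by omega)] at d1 d2
      omega
    · exact absurd (horder x y (by omega)) (not_lt.2 hxy.le)
    · rw [hx0, hy0] at d1 d2
      rw [if_pos rfl, if_neg (by omega)] at d1 d2
      omega
    · rw [hx0, hy0] at d1 d2
      rw [if_pos rfl, if_pos rfl] at d1 d2
      omega

lemma cmp2_pot {x y : X} (hxy : x < y) {n : ℕ} {A : Finset (X →₀ ℕ)}
    (hA : ∀ u ∈ A, degM u = n) (hne : cmp2 x y n A ≠ A) :
    ∑ u ∈ cmp2 x y n A, toLex u < ∑ u ∈ A, toLex u := by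
  refine pot_lt A (cmp2 x y n A) (fun u => toLex u) (ky x y) (cmp2_cls_card hxy.ne hA) ?_ hne
  intro u hu _ w hw hw' hk
  have h1 := (mem_cmp2.1 hu).2
  have h2 : ¬ w x < (cls x y A (ky x y w)).card := fun h => hw' (mem_cmp2.2 ⟨hA w hw, h⟩)
  rw [hk] at h1
  rw [lexlt_iff]
  refine ⟨x, ?_, by omega⟩
  intro z hz
  exact ky_eq_iff.1 hk z hz.ne (hz.trans hxy).ne

lemma exists_stb {c : X → ℕ} {i a : ℕ} (hi : 1 ≤ i) (horder : ∀ x y : X, c x < c y → y < x)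
    {P : Finset X} (hP : ∀ x ∈ P, c x = 0 ∨ c x = i) {n : ℕ} :
    ∀ (π : Lex (X →₀ ℕ)) (A : Finset (X →₀ ℕ)), ∑ u ∈ A, toLex u = π →
      (∀ u ∈ A, TT c i a P (n + 1) u) →
    ∃ A' : Finset (X →₀ ℕ), (∀ u ∈ A', TT c i a P (n + 1) u) ∧ Stb P A' ∧ A'.card = A.card ∧
      (shd A').card ≤ (shd A).card := by
  intro π
  induction π using WellFoundedLT.induction with
  | ind π ih =>
    intro A hπ hA
    by_cases hs : Stb P A
    · exact ⟨A, hA, hs, rfl, le_rfl⟩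
    · unfold Stb at hs
      push Not at hs
      obtain ⟨x, hx, y, hy, hxy, u, hu1, hu2⟩ := hs
      have hdeg : ∀ u ∈ A, degM u = n + 1 := fun u hu => (hA u hu).2.1
      have hdeg' : ∀ u ∈ shd A, degM u = n := by
        intro u hu
        obtain ⟨z, hz⟩ := mem_shd.1 hu
        have := hdeg _ hz
        rw [degM_add, degM_single] at this
        omega
      have hne : cmp2 x y (n + 1) A ≠ A := by
        intro he
        apply hu2
        have h1 := hu1
        rw [← he, mem_cmp2] at h1 ⊢
        obtain ⟨h2, h3⟩ := h1
        rw [degM_add, degM_single] at h2 ⊢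
        refine ⟨h2, ?_⟩
        have hk : ky x y (u + Finsupp.single y 1) = ky x y (u + Finsupp.single x 1) := by
          rw [ky_eq_iff]
          intro z hzx hzy
          simp [Finsupp.single_apply, Ne.symm hzx, Ne.symm hzy]
        rw [hk]
        refine lt_of_le_of_lt ?_ h3
        simp [Finsupp.single_apply, hxy.ne']
      have hlt := cmp2_pot hxy hdeg hne
      rw [hπ] at hlt
      obtain ⟨A', h1, h2, h3, h4⟩ := ih _ hlt (cmp2 x y (n + 1) A) rfl
        (cmp2_TT hi horder hP hx hy hxy hA)
      refine ⟨A', h1, h2, h3.trans (cmp2_card hxy.ne hdeg), h4.trans ?_⟩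
      rw [← cmp2_card hxy.ne hdeg']
      exact Finset.card_le_card (shd_cmp2 hxy.ne hdeg)

theorem mac {c : X → ℕ} {i a : ℕ} (hi : 1 ≤ i) (horder : ∀ x y : X, c x < c y → y < x)
    {P : Finset X} (hP : ∀ x ∈ P, c x = 0 ∨ c x = i) {n : ℕ} {A L : Finset (X →₀ ℕ)}
    (hA : ∀ u ∈ A, TT c i a P (n + 1) u) (hL : Ini (TT c i a P (n + 1)) L)
    (hc : L.card = A.card) : (shd L).card ≤ (shd A).card := by
  obtain ⟨A', h1, h2, h3, h4⟩ := exists_stb hi horder hP _ A rfl hA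
  exact (mac_stb hi horder P hP _ A' L h1 h2 hL (hc.trans h3.symm)).trans h4

lemma innp_apply (c : X → ℕ) (i : ℕ) (u : X →₀ ℕ) (x : X) :
    innp c i u x = if c x = 0 ∨ c x = i then u x else 0 := rfl

lemma outp_apply (c : X → ℕ) (i : ℕ) (u : X →₀ ℕ) (x : X) :
    outp c i u x = if c x ≠ 0 ∧ c x ≠ i then u x else 0 := rfl

lemma innp_add_outp (c : X → ℕ) (i : ℕ) (u : X →₀ ℕ) : innp c i u + outp c i u = u := by
  ext x
  rw [Finsupp.add_apply, innp_apply, outp_apply]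
  split_ifs <;> first | omega | tauto

lemma innp_add (c : X → ℕ) (i : ℕ) (u v : X →₀ ℕ) :
    innp c i (u + v) = innp c i u + innp c i v := by
  ext x
  simp only [Finsupp.add_apply, innp_apply]
  split_ifs <;> simp

lemma outp_add (c : X → ℕ) (i : ℕ) (u v : X →₀ ℕ) :
    outp c i (u + v) = outp c i u + outp c i v := by
  ext x
  simp only [Finsupp.add_apply, outp_apply]
  split_ifs <;> simp

lemma innp_of_supp {c : X → ℕ} {i : ℕ} {w : X →₀ ℕ}
    (h : ∀ x, ¬ (c x = 0 ∨ c x = i) → w x = 0) : innp c i w = w ∧ outp c i w = 0 := by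
  constructor
  · ext x
    rw [innp_apply]
    split_ifs with hx
    · rfl
    · exact (h x hx).symm
  · ext x
    rw [outp_apply]
    split_ifs with hx
    · exact h x (by tauto)
    · rfl

lemma outp_of_supp {c : X → ℕ} {i : ℕ} {w : X →₀ ℕ}
    (h : ∀ x, (c x = 0 ∨ c x = i) → w x = 0) : innp c i w = 0 ∧ outp c i w = w := by
  constructor
  · ext x
    rw [innp_apply]
    split_ifs with hx
    · exact h x hx
    · rfl
  · ext x
    rw [outp_apply]
    split_ifs with hx
    · rfl
    · exact (h x (by tauto)).symm

lemma innp_supp (c : X → ℕ) (i : ℕ) (u : X →₀ ℕ) :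
    ∀ x, ¬ (c x = 0 ∨ c x = i) → innp c i u x = 0 := by
  intro x hx
  rw [innp_apply, if_neg hx]

lemma outp_supp (c : X → ℕ) (i : ℕ) (u : X →₀ ℕ) :
    ∀ x, (c x = 0 ∨ c x = i) → outp c i u x = 0 := by
  intro x hx
  rw [outp_apply, if_neg (by tauto)]

lemma degM_split (c : X → ℕ) (i : ℕ) (u : X →₀ ℕ) :
    degM u = degM (innp c i u) + degM (outp c i u) := by
  rw [← degM_add, innp_add_outp]

lemma degC_innp (c : X → ℕ) (i : ℕ) (u : X →₀ ℕ) : degC c i (innp c i u) = degC c i u := by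
  unfold degC
  apply Finset.sum_congr rfl
  intro x hx
  have := (Finset.mem_filter.1 hx).2
  rw [innp_apply, if_pos (Or.inr this)]

lemma degC_outp (c : X → ℕ) {i k : ℕ} (h1 : 1 ≤ k) (hk : k ≠ i) (u : X →₀ ℕ) :
    degC c k (outp c i u) = degC c k u := by
  unfold degC
  apply Finset.sum_congr rfl
  intro x hx
  have := (Finset.mem_filter.1 hx).2
  rw [outp_apply, if_pos ⟨by omega, by omega⟩]

lemma firstSeg_spec (W : Finset (X →₀ ℕ)) (k : ℕ) (hk : k ≤ W.card) :
    Ini (fun u => u ∈ W) (firstSeg W k) ∧ (firstSeg W k).card = k := by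
  classical
  obtain ⟨L, hL, hc⟩ := exists_ini W k hk
  have : firstSeg W k = L := by
    ext u
    unfold firstSeg
    rw [Finset.mem_filter]
    constructor
    · rintro ⟨hu, hle⟩
      by_contra hn
      have hss : L ⊂ W.filter (fun ν => ν = u ∨ MonRevGT ν u) := by
        rw [Finset.ssubset_iff_of_subset]
        · exact ⟨u, Finset.mem_filter.2 ⟨hu, Or.inl rfl⟩, hn⟩
        · intro w hw
          refine Finset.mem_filter.2 ⟨hL.1 w hw, Or.inr ?_⟩
          rw [revGT_iff]
          by_contra hlt
          exact hn (hL.2 w hw u hu (not_lt.1 hlt))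
      have := Finset.card_lt_card hss
      have h2 : (W.filter (fun ν => ν = u ∨ MonRevGT ν u)).card ≤ k := by convert hle
      omega
    · intro hu
      refine ⟨hL.1 u hu, ?_⟩
      rw [← hc]
      apply Finset.card_le_card
      intro w hw
      obtain ⟨h1, h2⟩ := Finset.mem_filter.1 hw
      rcases h2 with rfl | h2
      · exact hu
      · exact hL.2 u hu w h1 ((revGT_iff _ _).1 h2).le
  rw [this]
  exact ⟨hL, hc⟩

lemma firstSeg_mono (W : Finset (X →₀ ℕ)) {k l : ℕ} (h : k ≤ l) :
    firstSeg W k ⊆ firstSeg W l := by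
  intro u hu
  unfold firstSeg at hu ⊢
  rw [Finset.mem_filter] at hu ⊢
  exact ⟨hu.1, hu.2.trans h⟩

lemma firstSeg_sub (W : Finset (X →₀ ℕ)) (k : ℕ) : firstSeg W k ⊆ W := Finset.filter_subset _ _

lemma firstSeg_pos {W : Finset (X →₀ ℕ)} {k : ℕ} {u : X →₀ ℕ} (hu : u ∈ firstSeg W k) :
    0 < k := by
  classical
  unfold firstSeg at hu
  rw [Finset.mem_filter] at hu
  exact lt_of_lt_of_le (Finset.card_pos.2 ⟨u, Finset.mem_filter.2 ⟨hu.1, Or.inl rfl⟩⟩) hu.2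

lemma mem_fiber {c : X → ℕ} {i : ℕ} {M : Finset (X →₀ ℕ)} {ν f : X →₀ ℕ} :
    f ∈ fiber c i M ν ↔ ∃ v ∈ M, outp c i v = ν ∧ innp c i v = f := by
  simp only [fiber, Finset.mem_image, Finset.mem_filter]
  constructor
  · rintro ⟨v, ⟨h1, h2⟩, h3⟩; exact ⟨v, h1, h2, h3⟩
  · rintro ⟨v, h1, h2, h3⟩; exact ⟨v, ⟨h1, h2⟩, h3⟩

/-- The class of a monomial with respect to `C_i`. -/
noncomputable def clo (c : X → ℕ) (i : ℕ) (u : X →₀ ℕ) : (X →₀ ℕ) × ℕ :=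
  (outp c i u, degM (innp c i u))

lemma clo_inj {c : X → ℕ} {i : ℕ} {B : Finset (X →₀ ℕ)} {k : (X →₀ ℕ) × ℕ} :
    Set.InjOn (innp c i) (B.filter (fun u => clo c i u = k)) := by
  intro u hu v hv h
  have hu := (Finset.mem_filter.1 hu).2
  have hv := (Finset.mem_filter.1 hv).2
  have : outp c i u = outp c i v := congrArg Prod.fst (hu.trans hv.symm)
  rw [← innp_add_outp c i u, ← innp_add_outp c i v, h, this]

lemma fvec_fiber (c : X → ℕ) (i : ℕ) (M : Finset (X →₀ ℕ)) (ν : X →₀ ℕ) (j : ℕ) :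
    FVec (fiber c i M ν) j = (M.filter (fun u => clo c i u = (ν, j))).card := by
  rw [← Finset.card_image_of_injOn clo_inj]
  unfold FVec
  congr 1
  ext f
  simp only [Finset.mem_filter, mem_fiber, Finset.mem_image, clo, Prod.mk.injEq]
  constructor
  · rintro ⟨⟨v, h1, h2, rfl⟩, h4⟩
    exact ⟨v, ⟨h1, h2, h4⟩, rfl⟩
  · rintro ⟨v, ⟨h1, h2, h3⟩, rfl⟩
    exact ⟨⟨v, h1, h2, rfl⟩, h3⟩

lemma divClosed_of_step {C : Finset (X →₀ ℕ)}
    (h : ∀ (u : X →₀ ℕ) x, u + Finsupp.single x 1 ∈ C → u ∈ C) : DivClosed C := by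
  have key : ∀ δ u : X →₀ ℕ, u + δ ∈ C → u ∈ C := by
    intro δ
    induction δ using Finsupp.induction_linear with
    | zero => intro u hu; simpa using hu
    | add f g hf hg =>
      intro u hu
      rw [← add_assoc] at hu
      exact hf u (hg _ hu)
    | single x b =>
      induction b with
      | zero => intro u hu; simpa using hu
      | succ b ih =>
        intro u hu
        rw [Finsupp.single_add, ← add_assoc] at hu
        exact ih u (h _ _ hu)
  intro μ hμ ν hν
  apply key (μ - ν)
  rw [add_tsub_cancel_of_le]
  · exact hμ
  · exact hν

section main

variable {c : X → ℕ} {a : ℕ → ℕ} {m d i : ℕ} {Amb : ℕ → ℕ → Finset (X →₀ ℕ)}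
  {M : Finset (X →₀ ℕ)}

/-- The ambient sets at `i` are the right ones. -/
def AmbOK (c : X → ℕ) (a : ℕ → ℕ) (i : ℕ) (Amb : ℕ → ℕ → Finset (X →₀ ℕ)) : Prop :=
  ∀ j, ∀ μ : X →₀ ℕ,
      (μ ∈ Amb i j ↔ ((∀ x, ¬ (c x = 0 ∨ c x = i) → μ x = 0) ∧ degM μ = j ∧ degC c i μ ≤ a i))

lemma mem_CiOp (hAmb : AmbOK c a i Amb) (hMS : ∀ μ ∈ M, InS c a m d μ) (u : X →₀ ℕ) :
    u ∈ CiOp Amb c d i M ↔ innp c i u ∈ firstSeg (Amb i (degM (innp c i u)))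
      (FVec (fiber c i M (outp c i u)) (degM (innp c i u))) := by
  unfold CiOp compFiber
  simp only [Finset.mem_biUnion, Finset.mem_image, Finset.mem_range]
  constructor
  · rintro ⟨ν, ⟨v, hv, rfl⟩, w, ⟨j, hj, hw⟩, rfl⟩
    obtain ⟨h1, h2, h3⟩ := (hAmb j w).1 (firstSeg_sub _ _ hw)
    obtain ⟨e1, e2⟩ := innp_of_supp h1
    obtain ⟨e3, e4⟩ := outp_of_supp (outp_supp c i v)
    rw [innp_add, outp_add, e1, e2, e3, e4, add_zero, zero_add, h2]
    exact hw
  · intro h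
    have hpos := firstSeg_pos h
    rw [fvec_fiber] at hpos
    obtain ⟨v, hv⟩ := Finset.card_pos.1 hpos
    obtain ⟨hvM, hvc⟩ := Finset.mem_filter.1 hv
    simp only [clo, Prod.mk.injEq] at hvc
    refine ⟨outp c i u, ⟨v, hvM, hvc.1⟩, innp c i u, ⟨degM (innp c i u), ?_, h⟩,
      innp_add_outp c i u⟩
    have h1 := (hMS v hvM).1
    rw [degM_split c i v] at h1
    omega

lemma innp_mem_amb (hi : 1 ≤ i) (him : i ≤ m) (hAmb : AmbOK c a i Amb)
    {u : X →₀ ℕ} (hu : InS c a m d u) : innp c i u ∈ Amb i (degM (innp c i u)) := by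
  rw [hAmb]
  refine ⟨innp_supp c i u, rfl, ?_⟩
  rw [degC_innp]
  exact hu.2 i hi him

lemma fvec_le_amb (hi : 1 ≤ i) (him : i ≤ m) (hAmb : AmbOK c a i Amb)
    (hMS : ∀ μ ∈ M, InS c a m d μ) (ν : X →₀ ℕ) (j : ℕ) :
    FVec (fiber c i M ν) j ≤ (Amb i j).card := by
  unfold FVec
  apply Finset.card_le_card
  intro f hf
  obtain ⟨h1, h2⟩ := Finset.mem_filter.1 hf
  obtain ⟨v, hv, h3, rfl⟩ := mem_fiber.1 h1
  rw [← h2]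
  exact innp_mem_amb hi him hAmb (hMS v hv)

lemma clo_card (hi : 1 ≤ i) (him : i ≤ m) (hAmb : AmbOK c a i Amb)
    (hMS : ∀ μ ∈ M, InS c a m d μ) (k : (X →₀ ℕ) × ℕ) :
    ((CiOp Amb c d i M).filter (fun u => clo c i u = k)).card
      = (M.filter (fun u => clo c i u = k)).card := by
  obtain ⟨ν, j⟩ := k
  have hspec := firstSeg_spec (Amb i j) _ (fvec_le_amb hi him hAmb hMS ν j)
  rw [← fvec_fiber c i M ν j]
  refine Eq.trans ?_ hspec.2
  rw [← Finset.card_image_of_injOn (clo_inj (c := c) (i := i) (B := CiOp Amb c d i M) (k := (ν, j)))]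
  congr 1
  ext f
  simp only [Finset.mem_image, Finset.mem_filter, clo, Prod.mk.injEq]
  constructor
  · rintro ⟨u, ⟨hu, rfl, rfl⟩, rfl⟩
    exact (mem_CiOp hAmb hMS u).1 hu
  · intro hf
    have hpos := firstSeg_pos hf
    rw [fvec_fiber] at hpos
    obtain ⟨v, hv⟩ := Finset.card_pos.1 hpos
    obtain ⟨hvM, hvc⟩ := Finset.mem_filter.1 hv
    simp only [clo, Prod.mk.injEq] at hvc
    obtain ⟨h1, h2, h3⟩ := (hAmb j f).1 (firstSeg_sub _ _ hf)
    obtain ⟨e1, e2⟩ := innp_of_supp h1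
    obtain ⟨e3, e4⟩ := outp_of_supp (outp_supp c i v)
    rw [hvc.1] at e3 e4
    have e5 : innp c i (f + ν) = f := by rw [innp_add, e1, e3, add_zero]
    have e6 : outp c i (f + ν) = ν := by rw [outp_add, e2, e4, zero_add]
    refine ⟨f + ν, ⟨?_, e6, by rw [e5, h2]⟩, e5⟩
    rw [mem_CiOp hAmb hMS, e5, e6, h2]
    exact hf

lemma CiOp_pot (hi : 1 ≤ i) (him : i ≤ m) (hAmb : AmbOK c a i Amb)
    (hMS : ∀ μ ∈ M, InS c a m d μ) (hne : CiOp Amb c d i M ≠ M) :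
    ∑ u ∈ CiOp Amb c d i M, toLex u < ∑ u ∈ M, toLex u := by
  refine pot_lt M (CiOp Amb c d i M) (fun u => toLex u) (clo c i) (clo_card hi him hAmb hMS) ?_ hne
  intro u hu _ w hw hw' hk
  simp only [clo, Prod.mk.injEq] at hk
  rw [mem_CiOp hAmb hMS] at hu hw'
  rw [hk.1, hk.2] at hu
  have hwA := innp_mem_amb hi him hAmb (hMS w hw)
  have hspec := firstSeg_spec _ _ (fvec_le_amb hi him hAmb hMS (outp c i w) (degM (innp c i w)))
  have hlt : toLex (innp c i u) < toLex (innp c i w) := by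
    by_contra hn
    exact hw' (hspec.1.2 _ hu _ hwA (not_lt.1 hn))
  rw [← innp_add_outp c i u, ← innp_add_outp c i w, hk.1, toLex_add, toLex_add]
  exact (add_lt_add_iff_right _).2 hlt

lemma CiOp_exists (hi : 1 ≤ i) (him : i ≤ m) (hAmb : AmbOK c a i Amb)
    (hMS : ∀ μ ∈ M, InS c a m d μ) {u : X →₀ ℕ} (hu : u ∈ CiOp Amb c d i M) :
    ∃ v ∈ M, clo c i v = clo c i u := by
  have h1 : 0 < ((CiOp Amb c d i M).filter (fun v => clo c i v = clo c i u)).card :=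
    Finset.card_pos.2 ⟨u, Finset.mem_filter.2 ⟨hu, rfl⟩⟩
  rw [clo_card hi him hAmb hMS] at h1
  obtain ⟨v, hv⟩ := Finset.card_pos.1 h1
  exact ⟨v, (Finset.mem_filter.1 hv)⟩

lemma CiOp_InS (hi : 1 ≤ i) (him : i ≤ m) (hAmb : AmbOK c a i Amb)
    (hMS : ∀ μ ∈ M, InS c a m d μ) : ∀ μ ∈ CiOp Amb c d i M, InS c a m d μ := by
  intro u hu
  obtain ⟨v, hv, hc⟩ := CiOp_exists hi him hAmb hMS hu
  simp only [clo, Prod.mk.injEq] at hc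
  obtain ⟨h1, h2⟩ := hMS v hv
  constructor
  · rw [degM_split c i u, ← hc.1, ← hc.2, ← degM_split]; exact h1
  · intro k hk1 hkm
    by_cases hki : k = i
    · subst hki
      rw [← degC_innp]
      exact ((hAmb _ _).1 (firstSeg_sub _ _ ((mem_CiOp hAmb hMS u).1 hu))).2.2
    · rw [← degC_outp c hk1 hki, ← hc.1, degC_outp c hk1 hki]
      exact h2 k hk1 hkm

lemma CiOp_div (hi : 1 ≤ i) (him : i ≤ m) (horder : ∀ x y : X, c x < c y → y < x)
    (hAmb : AmbOK c a i Amb) (hMS : ∀ μ ∈ M, InS c a m d μ) (hdc : DivClosed M) :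
    DivClosed (CiOp Amb c d i M) := by
  apply divClosed_of_step
  intro u x hu
  rw [mem_CiOp hAmb hMS] at hu ⊢
  have hdiv : ∀ (w : X →₀ ℕ) (y : X), w + Finsupp.single y 1 ∈ M → w ∈ M := by
    intro w y hw
    exact hdc _ hw w (fun z => by simp)
  by_cases hx : c x = 0 ∨ c x = i
  · have hs : innp c i (Finsupp.single x 1) = Finsupp.single x 1
        ∧ outp c i (Finsupp.single x 1) = 0 := by
      apply innp_of_supp
      intro y hy
      have : x ≠ y := fun e => hy (e ▸ hx)
      simp [Finsupp.single_apply, this]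
    rw [innp_add, outp_add, hs.1, hs.2, add_zero, degM_add, degM_single] at hu
    set ν := outp c i u with hν
    set j := degM (innp c i u) with hj
    let P : Finset X := Finset.univ.filter (fun x => c x = 0 ∨ c x = i)
    have hP : ∀ x ∈ P, c x = 0 ∨ c x = i := fun x hx => (Finset.mem_filter.1 hx).2
    have hAT : ∀ n (w : X →₀ ℕ), w ∈ Amb i n ↔ TT c i (a i) P n w := by
      intro n w
      rw [hAmb, TT]
      simp [P]
    have hIni : ∀ n, Ini (TT c i (a i) P n) (firstSeg (Amb i n) (FVec (fiber c i M ν) n))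
        ∧ (firstSeg (Amb i n) (FVec (fiber c i M ν) n)).card = FVec (fiber c i M ν) n := by
      intro n
      obtain ⟨⟨h1, h2⟩, h3⟩ := firstSeg_spec _ _ (fvec_le_amb hi him hAmb hMS ν n)
      exact ⟨⟨fun w hw => (hAT n w).1 (h1 w hw),
        fun w hw z hz => h2 w hw z ((hAT n z).2 hz)⟩, h3⟩
    have hsub : shd (firstSeg (Amb i (j + 1)) (FVec (fiber c i M ν) (j + 1)))
        ⊆ firstSeg (Amb i j) (FVec (fiber c i M ν) j) := by
      refine (shd_ini hi horder hP (hIni (j + 1)).1).nested (hIni j).1 ?_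
      rw [(hIni j).2]
      refine (mac hi horder hP (A := (fiber c i M ν).filter (fun μ => degM μ = j + 1)) ?_
        (hIni (j + 1)).1 (hIni (j + 1)).2).trans ?_
      · intro f hf
        obtain ⟨h1, h2⟩ := Finset.mem_filter.1 hf
        obtain ⟨v, hv, h3, rfl⟩ := mem_fiber.1 h1
        rw [← hAT, ← h2]
        exact innp_mem_amb hi him hAmb (hMS v hv)
      · apply Finset.card_le_card
        intro f hf
        obtain ⟨y, hy⟩ := mem_shd.1 hf
        obtain ⟨h1, h2⟩ := Finset.mem_filter.1 hy
        rw [degM_add, degM_single] at h2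
        refine Finset.mem_filter.2 ⟨?_, by omega⟩
        obtain ⟨v, hv, h3, h4⟩ := mem_fiber.1 h1
        have hfs : ∀ x, ¬ (c x = 0 ∨ c x = i) → f x = 0 := by
          intro z hz
          have := innp_supp c i v z hz
          rw [h4] at this
          simp only [Finsupp.add_apply] at this
          omega
        obtain ⟨e1, e2⟩ := innp_of_supp hfs
        obtain ⟨e3, e4⟩ := outp_of_supp (outp_supp c i u)
        refine mem_fiber.2 ⟨f + ν, ?_, ?_, ?_⟩
        · apply hdiv (f + ν) y
          have := innp_add_outp c i v
          rw [h4, h3] at this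
          rw [add_right_comm, this]
          exact hv
        · rw [outp_add, e2, hν, e4, zero_add]
        · rw [innp_add, e1, hν, e3, add_zero]
    exact hsub (mem_shd.2 ⟨x, hu⟩)
  · have hs : innp c i (Finsupp.single x 1) = 0
        ∧ outp c i (Finsupp.single x 1) = Finsupp.single x 1 := by
      apply outp_of_supp
      intro y hy
      have : x ≠ y := fun e => hx (e ▸ hy)
      simp [Finsupp.single_apply, this]
    rw [innp_add, outp_add, hs.1, hs.2, add_zero] at hu
    refine firstSeg_mono _ ?_ hu
    unfold FVec
    apply Finset.card_le_card
    apply Finset.filter_subset_filter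
    intro f hf
    obtain ⟨v, hv, h3, h4⟩ := mem_fiber.1 hf
    have hvx : 1 ≤ v x := by
      have := DFunLike.congr_fun h3 x
      rw [outp_apply, if_pos (by tauto)] at this
      simp at this
      omega
    have hve := sub_add_single' v x 1 hvx
    refine mem_fiber.2 ⟨v - Finsupp.single x 1, hdiv _ x (by rw [hve]; exact hv), ?_, ?_⟩
    · rw [← hve, outp_add, hs.2] at h3
      exact add_right_cancel h3
    · rw [← hve, innp_add, hs.1, add_zero] at h4
      exact h4

lemma CiOp_fvec (hi : 1 ≤ i) (him : i ≤ m) (hAmb : AmbOK c a i Amb)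
    (hMS : ∀ μ ∈ M, InS c a m d μ) (j : ℕ) : FVec (CiOp Amb c d i M) j = FVec M j := by
  unfold FVec
  apply card_of_classes (clo c i)
  intro k
  rw [Finset.filter_filter, Finset.filter_filter]
  by_cases hk : k.2 + degM k.1 = j
  · have e : ∀ B : Finset (X →₀ ℕ), B.filter (fun u => degM u = j ∧ clo c i u = k)
        = B.filter (fun u => clo c i u = k) := by
      intro B
      apply Finset.filter_congr
      intro u _
      constructor
      · exact fun h => h.2
      · rintro rfl
        refine ⟨?_, rfl⟩
        rw [degM_split c i u]; exact hk
    rw [e, e]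
    exact clo_card hi him hAmb hMS k
  · have e : ∀ B : Finset (X →₀ ℕ), B.filter (fun u => degM u = j ∧ clo c i u = k) = ∅ := by
      intro B
      apply Finset.filter_eq_empty_iff.2
      rintro u _ ⟨h1, rfl⟩
      apply hk
      rw [← h1, degM_split c i u]; rfl
    rw [e, e]

lemma degM_potM (B : Finset (X →₀ ℕ)) : degM (potM B) = ∑ u ∈ B, degM u := by
  unfold potM degM
  rw [Finset.sum_comm]
  apply Finset.sum_congr rfl
  intro x _
  rw [Finsupp.finset_sum_apply]

lemma sum_degM_eq {A B : Finset (X →₀ ℕ)} (h : ∀ j, FVec B j = FVec A j) :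
    ∑ u ∈ B, degM u = ∑ u ∈ A, degM u := by
  have m1 : ∀ u ∈ B, degM u ∈ B.image degM ∪ A.image degM := by
    intro u hu; exact Finset.mem_union_left _ (Finset.mem_image_of_mem _ hu)
  have m2 : ∀ u ∈ A, degM u ∈ B.image degM ∪ A.image degM := by
    intro u hu; exact Finset.mem_union_right _ (Finset.mem_image_of_mem _ hu)
  rw [← Finset.sum_fiberwise_of_maps_to m1, ← Finset.sum_fiberwise_of_maps_to m2]
  apply Finset.sum_congr rfl
  intro j _
  have key : ∀ C : Finset (X →₀ ℕ), ∑ u ∈ C.filter (fun u => degM u = j), degM u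
      = FVec C j * j := by
    intro C
    unfold FVec
    rw [Finset.sum_congr rfl (fun u hu => (Finset.mem_filter.1 hu).2)]
    simp
  rw [key, key, h]

lemma toLex_potM (B : Finset (X →₀ ℕ)) : toLex (potM B) = ∑ u ∈ B, toLex u := by
  unfold potM
  induction B using Finset.induction_on with
  | empty => rfl
  | insert u s hu ih => rw [Finset.sum_insert hu, Finset.sum_insert hu, toLex_add, ih]

lemma CiOp_first (hi : 1 ≤ i) (him : i ≤ m) (hAmb : AmbOK c a i Amb)
    (hMS : ∀ μ ∈ M, InS c a m d μ) :
      degM (potM (CiOp Amb c d i M)) = degM (potM M) ∧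
      (potM (CiOp Amb c d i M) = potM M ∨ MonRevGT (potM (CiOp Amb c d i M)) (potM M)) ∧
      (potM (CiOp Amb c d i M) = potM M ↔ CiOp Amb c d i M = M) := by
  refine ⟨?_, ?_, ?_⟩
  · rw [degM_potM, degM_potM]
    exact sum_degM_eq (CiOp_fvec hi him hAmb hMS)
  · by_cases h : CiOp Amb c d i M = M
    · left; rw [h]
    · right
      rw [revGT_iff, toLex_potM, toLex_potM]
      exact CiOp_pot hi him hAmb hMS h
  · constructor
    · intro h
      by_contra hne
      have := CiOp_pot hi him hAmb hMS hne
      rw [← toLex_potM, ← toLex_potM, h] at this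
      exact lt_irrefl _ this
    · intro h; rw [h]

lemma compressed_of_fix (hi : 1 ≤ i) (him : i ≤ m) (hAmb : AmbOK c a i Amb)
    (hMS : ∀ μ ∈ M, InS c a m d μ) (hfix : CiOp Amb c d i M = M) :
    Compressed0i c a m d i M := by
  intro μ hμ μ' hS hdeg hout hgt
  have ho : outp c i μ' = outp c i μ := by
    ext x
    rw [outp_apply, outp_apply]
    split_ifs with h
    · exact hout x h.1 h.2
    · rfl
  have hd : degM (innp c i μ') = degM (innp c i μ) := by
    rw [degM_split c i μ', degM_split c i μ, ho] at hdeg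
    omega
  have hA' := innp_mem_amb hi him hAmb hS
  rw [← hfix, mem_CiOp hAmb hMS] at hμ ⊢
  rw [ho, hd]
  rw [hd] at hA'
  refine (firstSeg_spec _ _ (fvec_le_amb hi him hAmb hMS _ _)).1.2 _ hμ _ hA' ?_
  apply le_of_lt
  rw [lexlt_iff]
  obtain ⟨x, h1, h2, h3⟩ := hgt
  refine ⟨x, ?_, ?_⟩
  · intro y hy
    rw [innp_apply, innp_apply]
    split_ifs with h
    · exact h3 y h hy
    · rfl
  · rw [innp_apply, innp_apply, if_pos h1, if_pos h1]
    exact h2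

end main

/-- The potential `m_M` strictly increases in revlex under compression (with constant
degree), with equality exactly at fixed points; consequently cyclic iteration of
`C_1, …, C_m` terminates at a `(0)`-compressed multicomplex with the same F-vector. -/
theorem stmt9 (c : X → ℕ) (a : ℕ → ℕ) (m d : ℕ)
    (hm1 : 1 ≤ m) (hm : ∀ x, c x ≤ m) (horder : ∀ x y : X, c x < c y → y < x)
    (ha : ∀ i, 1 ≤ i → i ≤ m → 0 < a i) (hd : 1 ≤ d)
    (Amb : ℕ → ℕ → Finset (X →₀ ℕ))
    (hAmb : ∀ i j, 1 ≤ i → i ≤ m → ∀ μ : X →₀ ℕ,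
      (μ ∈ Amb i j ↔ ((∀ x, ¬ (c x = 0 ∨ c x = i) → μ x = 0) ∧ degM μ = j ∧ degC c i μ ≤ a i)))
    (M : Finset (X →₀ ℕ)) (hMS : ∀ μ ∈ M, InS c a m d μ) (hMdc : DivClosed M) :
    (∀ i, 1 ≤ i → i ≤ m →
      degM (potM (CiOp Amb c d i M)) = degM (potM M) ∧
      (potM (CiOp Amb c d i M) = potM M ∨ MonRevGT (potM (CiOp Amb c d i M)) (potM M)) ∧
      (potM (CiOp Amb c d i M) = potM M ↔ CiOp Amb c d i M = M)) ∧
    (∃ k : ℕ, (∀ i, 1 ≤ i → i ≤ m → CiOp Amb c d i (seqM Amb c m d M k) = seqM Amb c m d M k) ∧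
      (∀ i, 1 ≤ i → i ≤ m → Compressed0i c a m d i (seqM Amb c m d M k)) ∧
      (∀ μ ∈ seqM Amb c m d M k, InS c a m d μ) ∧
      DivClosed (seqM Amb c m d M k) ∧
      ∀ j, FVec (seqM Amb c m d M k) j = FVec M j) := by
  have hOK : ∀ i, 1 ≤ i → i ≤ m → AmbOK c a i Amb := fun i h1 h2 j => hAmb i j h1 h2
  refine ⟨fun i h1 h2 => CiOp_first h1 h2 (hOK i h1 h2) hMS, ?_⟩
  have hidx : ∀ t, 1 ≤ t % m + 1 ∧ t % m + 1 ≤ m := by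
    intro t
    have := Nat.mod_lt t (by omega : 0 < m)
    omega
  have hinv : ∀ t, (∀ μ ∈ seqM Amb c m d M t, InS c a m d μ) ∧ DivClosed (seqM Amb c m d M t) ∧
      ∀ j, FVec (seqM Amb c m d M t) j = FVec M j := by
    intro t
    induction t with
    | zero => exact ⟨hMS, hMdc, fun _ => rfl⟩
    | succ t ih =>
      obtain ⟨i1, i2, i3⟩ := ih
      obtain ⟨h1, h2⟩ := hidx t
      refine ⟨CiOp_InS h1 h2 (hOK _ h1 h2) i1, CiOp_div h1 h2 horder (hOK _ h1 h2) i1 i2, ?_⟩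
      intro j
      rw [← i3 j]
      exact CiOp_fvec h1 h2 (hOK _ h1 h2) i1 j
  let π : ℕ → Lex (X →₀ ℕ) := fun t => ∑ u ∈ seqM Amb c m d M t, toLex u
  have hstep : ∀ t, seqM Amb c m d M (t + 1) = seqM Amb c m d M t ∨ π (t + 1) < π t := by
    intro t
    obtain ⟨h1, h2⟩ := hidx t
    by_cases h : seqM Amb c m d M (t + 1) = seqM Amb c m d M t
    · exact Or.inl h
    · exact Or.inr (CiOp_pot h1 h2 (hOK _ h1 h2) (hinv t).1 h)
  obtain ⟨_, ⟨k, rfl⟩, hmin⟩ := (wellFounded_lt (α := Lex (X →₀ ℕ))).has_min (Set.range π)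
    ⟨_, ⟨0, rfl⟩⟩
  have hconst : ∀ n, seqM Amb c m d M (k + n) = seqM Amb c m d M k := by
    intro n
    induction n with
    | zero => rfl
    | succ n ih =>
      rcases hstep (k + n) with h | h
      · exact h.trans ih
      · exfalso
        refine hmin (π (k + n + 1)) ⟨_, rfl⟩ ?_
        have : π (k + n) = π k := by simp only [π]; rw [ih]
        rw [this] at h
        exact h
  have hfix : ∀ i, 1 ≤ i → i ≤ m →
      CiOp Amb c d i (seqM Amb c m d M k) = seqM Amb c m d M k := by
    intro i h1 h2
    have hk : k ≤ k * m := Nat.le_mul_of_pos_right k (by omega)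
    have e1 := hconst (k * m - k + (i - 1))
    have e2 := hconst (k * m - k + (i - 1) + 1)
    rw [show k + (k * m - k + (i - 1)) = (i - 1) + k * m by omega] at e1
    rw [show k + (k * m - k + (i - 1) + 1) = ((i - 1) + k * m) + 1 by omega] at e2
    change CiOp Amb c d (((i - 1) + k * m) % m + 1) (seqM Amb c m d M ((i - 1) + k * m)) = _ at e2
    rw [e1, Nat.add_mul_mod_self_right, Nat.mod_eq_of_lt (by omega), Nat.sub_add_cancel h1] at e2
    exact e2
  exact ⟨k, hfix, fun i h1 h2 => compressed_of_fix h1 h2 (hOK i h1 h2) (hinv k).1 (hfix i h1 h2),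
    (hinv k).1, (hinv k).2.1, (hinv k).2.2⟩
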